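/- For all λ ≥ 1, ε ≥ 0 and κ ≥ 0 there exists a constant C > 0, depending only on λ, ε and κ, with the following property: if φ, φ' : ℍ ×₂ ℝ → ℍ ×₂ ℝ are (λ,ε)-quasi-isometric embeddings satisfying dist(φ'(φ(x)), x) ≤ κ for all x, then for all x, y ∈ ℍ, letting l denote the hyperbolic distance between the ℍ-coordinates of φ(x,0) and φ(y,0), one has dist_ℍ(x, y) ≤ C·(exp(l) + 1). -/

import Mathlib

open UpperHalfPlane

/-- `ℍ ×₂ ℝ`: the product of the hyperbolic plane and the real line with the ℓ² metric. -/
abbrev H2R := WithLp 2 (UpperHalfPlane × ℝ)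

/-- The horizontal (ℍ-) coordinate of a point of `ℍ ×₂ ℝ`. -/
noncomputable def horiz (p : H2R) : UpperHalfPlane := (WithLp.equiv 2 (UpperHalfPlane × ℝ) p).1

/-- The point of `ℍ ×₂ ℝ` with horizontal coordinate `z` and vertical coordinate `t`. -/
noncomputable def mk2 (z : UpperHalfPlane) (t : ℝ) : H2R :=
  (WithLp.equiv 2 (UpperHalfPlane × ℝ)).symm (z, t)

/-- A `(λ,ε)`-quasi-isometric embedding between metric spaces. -/
def IsQIE {X Y : Type*} [PseudoMetricSpace X] [PseudoMetricSpace Y]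
    (lam eps : ℝ) (f : X → Y) : Prop :=
  ∀ x y, (1 / lam) * dist x y - eps ≤ dist (f x) (f y) ∧
    dist (f x) (f y) ≤ lam * dist x y + eps


noncomputable def vert (p : H2R) : ℝ := (WithLp.equiv 2 (UpperHalfPlane × ℝ) p).2

lemma horiz_mk2 (z : ℍ) (t : ℝ) : horiz (mk2 z t) = z := rfl
lemma vert_mk2 (z : ℍ) (t : ℝ) : vert (mk2 z t) = t := rfl
lemma mk2_eta (p : H2R) : mk2 (horiz p) (vert p) = p := rfl

lemma dist_H2R (p q : H2R) :
    dist p q = Real.sqrt (dist (horiz p) (horiz q) ^ 2 + |vert p - vert q| ^ 2) := by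
  rw [WithLp.prod_dist_eq_add (by norm_num), Real.sqrt_eq_rpow]
  norm_num [horiz, vert, Real.dist_eq]

lemma dist_horiz_le (p q : H2R) : dist (horiz p) (horiz q) ≤ dist p q := by
  rw [dist_H2R]
  exact Real.le_sqrt_of_sq_le (by nlinarith [sq_nonneg (|vert p - vert q|)])

lemma dist_vert_le (p q : H2R) : |vert p - vert q| ≤ dist p q := by
  rw [dist_H2R]
  exact Real.le_sqrt_of_sq_le (by nlinarith [sq_nonneg (dist (horiz p) (horiz q))])

lemma dist_le_add (p q : H2R) :
    dist p q ≤ dist (horiz p) (horiz q) + |vert p - vert q| := by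
  rw [dist_H2R]
  have h1 : 0 ≤ dist (horiz p) (horiz q) := dist_nonneg
  have h2 := abs_nonneg (vert p - vert q)
  exact Real.sqrt_le_iff.2 ⟨by positivity, by nlinarith [mul_nonneg h1 h2]⟩

lemma dist_mk2_same_horiz (z : ℍ) (s t : ℝ) : dist (mk2 z s) (mk2 z t) ≤ |s - t| := by
  have := dist_le_add (mk2 z s) (mk2 z t)
  simpa [horiz_mk2, vert_mk2] using this

lemma dist_mk2_same_vert (z w : ℍ) (s : ℝ) : dist (mk2 z s) (mk2 w s) ≤ dist z w := by
  have := dist_le_add (mk2 z s) (mk2 w s)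
  simpa [horiz_mk2, vert_mk2] using this

/-- disc coordinate centred at `z` -/
noncomputable def disc (z q : ℍ) : ℂ := ((q : ℂ) - z) / ((q : ℂ) - (starRingEnd ℂ) (z : ℂ))

lemma sub_conj_ne (z q : ℍ) : (q : ℂ) - (starRingEnd ℂ) (z : ℂ) ≠ 0 := by
  intro h
  have := congrArg Complex.im h
  simp at this
  have h1 := q.im_pos
  have h2 := z.im_pos
  linarith

lemma norm_disc_sub (z q q' : ℍ) :
    ‖disc z q - disc z q'‖ * (Real.cosh (dist q z / 2) * Real.cosh (dist q' z / 2))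
      = Real.sinh (dist q q' / 2) := by
  have e : disc z q - disc z q' =
      ((q : ℂ) - q') * ((z : ℂ) - (starRingEnd ℂ) (z : ℂ)) /
      (((q : ℂ) - (starRingEnd ℂ) (z : ℂ)) * ((q' : ℂ) - (starRingEnd ℂ) (z : ℂ))) := by
    have h1 := sub_conj_ne z q
    have h2 := sub_conj_ne z q'
    unfold disc
    field_simp
    ring
  have hz : ‖(z : ℂ) - (starRingEnd ℂ) (z : ℂ)‖ = 2 * z.im := by
    rw [Complex.sub_conj]
    have := z.im_pos
    simp [abs_of_pos this]
  have h1 : 0 < ‖(q : ℂ) - (starRingEnd ℂ) (z : ℂ)‖ := norm_pos_iff.2 (sub_conj_ne z q)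
  have h2 : 0 < ‖(q' : ℂ) - (starRingEnd ℂ) (z : ℂ)‖ := norm_pos_iff.2 (sub_conj_ne z q')
  rw [e, cosh_half_dist, cosh_half_dist, sinh_half_dist, norm_div, norm_mul, norm_mul, hz,
    dist_eq_norm, dist_eq_norm, dist_eq_norm]
  have a := z.im_pos
  have b := q.im_pos
  have c := q'.im_pos
  rw [Real.sqrt_mul b.le, Real.sqrt_mul c.le, Real.sqrt_mul b.le]
  have a' := Real.sqrt_pos.2 a
  have b' := Real.sqrt_pos.2 b
  have c' := Real.sqrt_pos.2 c
  have aa : z.im = √z.im * √z.im := (Real.mul_self_sqrt a.le).symm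
  generalize √z.im = sa at *
  field_simp
  rw [aa]
  ring

lemma norm_disc_sub_le (z q q' : ℍ) (r J : ℝ) (h1 : r ≤ dist q z) (h2 : r ≤ dist q' z)
    (hJ : dist q q' ≤ J) :
    ‖disc z q - disc z q'‖ ≤ 4 * Real.sinh (J / 2) * Real.exp (-r) := by
  have e := norm_disc_sub z q q'
  have c1 : Real.exp (r / 2) / 2 ≤ Real.cosh (dist q z / 2) := by
    rw [Real.cosh_eq]
    have : Real.exp (r / 2) ≤ Real.exp (dist q z / 2) := Real.exp_le_exp.2 (by linarith)
    have := Real.exp_pos (-(dist q z / 2))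
    linarith
  have c2 : Real.exp (r / 2) / 2 ≤ Real.cosh (dist q' z / 2) := by
    rw [Real.cosh_eq]
    have : Real.exp (r / 2) ≤ Real.exp (dist q' z / 2) := Real.exp_le_exp.2 (by linarith)
    have := Real.exp_pos (-(dist q' z / 2))
    linarith
  have s : Real.sinh (dist q q' / 2) ≤ Real.sinh (J / 2) := Real.sinh_le_sinh.2 (by linarith)
  have p : Real.exp (r / 2) / 2 * (Real.exp (r / 2) / 2) ≤
      Real.cosh (dist q z / 2) * Real.cosh (dist q' z / 2) := by
    gcongr
  have p' : Real.exp (r / 2) / 2 * (Real.exp (r / 2) / 2) = Real.exp r / 4 := by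
    have : Real.exp r = Real.exp (r / 2) * Real.exp (r / 2) := by
      rw [← Real.exp_add]; ring_nf
    rw [this]; ring
  rw [p'] at p
  have k : ‖disc z q - disc z q'‖ * (Real.exp r / 4) ≤ Real.sinh (J / 2) := by
    calc _ ≤ _ := mul_le_mul_of_nonneg_left p (norm_nonneg _)
      _ ≤ _ := by rw [e]; exact s
  rw [Real.exp_neg, ← div_eq_mul_inv, le_div_iff₀ (Real.exp_pos r)]
  linarith

/-- vertical motion in the half plane by hyperbolic distance `t` -/
noncomputable def up (z : ℍ) (t : ℝ) : ℍ :=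
  ⟨⟨z.re, z.im * Real.exp t⟩, mul_pos z.im_pos (Real.exp_pos t)⟩

lemma up_re (z : ℍ) (t : ℝ) : (up z t).re = z.re := rfl
lemma up_im (z : ℍ) (t : ℝ) : (up z t).im = z.im * Real.exp t := rfl
lemma up_zero (z : ℍ) : up z 0 = z := by
  apply UpperHalfPlane.ext
  apply Complex.ext
  · rfl
  · show z.im * Real.exp 0 = z.im
    simp

lemma dist_up (z : ℍ) (s t : ℝ) : dist (up z s) (up z t) = |s - t| := by
  rw [dist_of_re_eq (by rw [up_re, up_re]), up_im, up_im,
    Real.log_mul z.im_pos.ne' (Real.exp_pos _).ne', Real.log_mul z.im_pos.ne' (Real.exp_pos _).ne',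
    Real.log_exp, Real.log_exp, Real.dist_eq]
  congr 1; ring

lemma disc_up (z : ℍ) (t : ℝ) :
    disc z (up z t) = (((Real.exp t - 1) / (Real.exp t + 1) : ℝ) : ℂ) := by
  have h := sub_conj_ne z (up z t)
  have hp := Real.exp_pos t
  have h2 : ((Real.exp t + 1 : ℝ) : ℂ) ≠ 0 := by
    exact_mod_cast (by positivity : Real.exp t + 1 ≠ 0)
  unfold disc
  rw [Complex.ofReal_div, div_eq_div_iff h h2]
  apply Complex.ext
  · simp [up, -Complex.ofReal_exp]
  · simp [up, -Complex.ofReal_exp]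
    ring

lemma disc_up_sub (z : ℍ) (R : ℝ) (hR : 2 ≤ R) :
    1 ≤ ‖disc z (up z R) - disc z (up z (-R))‖ := by
  rw [disc_up, disc_up, ← Complex.ofReal_sub, Complex.norm_real, Real.norm_eq_abs]
  refine le_trans ?_ (le_abs_self _)
  have h1 : 3 ≤ Real.exp R := by linarith [Real.add_one_le_exp R]
  have h : Real.exp (-R) = (Real.exp R)⁻¹ := Real.exp_neg R
  rw [h]
  generalize Real.exp R = e at *
  have : (e⁻¹ - 1) / (e⁻¹ + 1) = - ((e-1)/(e+1)) := by
    field_simp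
    ring
  rw [this]
  have : 1/2 ≤ (e-1)/(e+1) := by
    rw [div_le_div_iff₀ (by norm_num) (by linarith)]
    linarith
  linarith

/-- chains along an interval -/
lemma chain_interval {X : Type*} [PseudoMetricSpace X] (F : ℝ → X) (η T : ℝ) (hT : 0 ≤ T)
    (hη : 0 ≤ η)
    (h : ∀ s t, 0 ≤ s → s ≤ T → 0 ≤ t → t ≤ T → |s - t| ≤ 1 → dist (F s) (F t) ≤ η) :
    dist (F 0) (F T) ≤ (T + 1) * η := by
  have key : ∀ n : ℕ, (n : ℝ) ≤ T → dist (F 0) (F n) ≤ n * η := by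
    intro n
    induction n with
    | zero => intro _; simp
    | succ k ih =>
      intro hk
      push_cast at hk ⊢
      have h0 : (0 : ℝ) ≤ k := Nat.cast_nonneg k
      have a := ih (by linarith)
      have b := h k (k + 1) h0 (by linarith) (by linarith) hk (by simp)
      have := dist_triangle (F 0) (F k) (F (k + 1))
      linarith
  have f1 := Nat.floor_le hT
  have f2 := Nat.lt_floor_add_one T
  have f0 : (0 : ℝ) ≤ (⌊T⌋₊ : ℝ) := Nat.cast_nonneg _
  have a := key _ f1
  have b := h (⌊T⌋₊) T f0 f1 hT le_rfl (by rw [abs_le]; constructor <;> linarith)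
  have := dist_triangle (F 0) (F ⌊T⌋₊) (F T)
  nlinarith

lemma chain_real {X : Type*} [PseudoMetricSpace X] (F : ℝ → X) (η K a b : ℝ)
    (hη : 0 ≤ η) (ha : |a| ≤ K) (hb : |b| ≤ K)
    (h : ∀ s t, |s| ≤ K → |t| ≤ K → |s - t| ≤ 1 → dist (F s) (F t) ≤ η) :
    dist (F a) (F b) ≤ (2 * K + 1) * η := by
  wlog hab : a ≤ b generalizing a b
  · rw [dist_comm]; exact this b a hb ha (by linarith)
  rw [abs_le] at ha hb
  have := chain_interval (fun s => F (a + s)) η (b - a) (by linarith) hη (by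
    intro s t hs hs' ht ht' hst
    exact h _ _ (by rw [abs_le]; constructor <;> linarith)
      (by rw [abs_le]; constructor <;> linarith) (by simpa using hst))
  simp only [add_zero, add_sub_cancel] at this
  nlinarith

lemma chain_H {X : Type*} [PseudoMetricSpace X] (F : ℍ → X) (η d : ℝ) (p q : ℍ)
    (hη : 0 ≤ η) (hd : dist p q ≤ d)
    (h : ∀ a b, dist a p ≤ 3 * d + 1 → dist b p ≤ 3 * d + 1 → dist a b ≤ 1 →
      dist (F a) (F b) ≤ η) :
    dist (F p) (F q) ≤ (3 * d + 3) * η := by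
  have d0 : 0 ≤ d := le_trans dist_nonneg hd
  have hp := p.im_pos
  have hq := q.im_pos
  set τ := Real.log (p.im / q.im) + d with hτ
  have hlog := dist_log_im_le p q
  rw [Real.dist_eq, ← Real.log_div hp.ne' hq.ne', abs_le] at hlog
  have t0 : 0 ≤ τ := by linarith
  have t1 : τ ≤ 2 * d := by linarith
  have im_eq : (up q τ).im = (up p d).im := by
    rw [up_im, up_im, hτ, Real.exp_add, Real.exp_log (by positivity)]
    field_simp
  have hover : dist (up p d) (up q τ) ≤ 1 := by
    refine le_trans (dist_le_dist_coe_div_sqrt _ _) ?_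
    rw [im_eq, Real.sqrt_mul_self (up p d).im_pos.le, div_le_one (up p d).im_pos, up_im]
    have e : dist ((up p d : ℍ) : ℂ) (up q τ) = |p.re - q.re| := by
      rw [Complex.dist_of_im_eq]
      · rfl
      · exact im_eq.symm
    rw [e]
    have e1 : |p.re - q.re| ≤ dist (p : ℂ) q := by
      rw [Complex.dist_eq]
      simpa using Complex.abs_re_le_norm ((p : ℂ) - q)
    have e2 := dist_coe_le q p
    rw [dist_comm (q : ℂ), dist_comm q] at e2
    have e3 : Real.exp (dist p q) ≤ Real.exp d := Real.exp_le_exp.2 hd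
    nlinarith
  have A := chain_interval (fun t => F (up p t)) η d d0 hη (by
    intro s t hs hs' ht ht' hst
    apply h
    · nth_rewrite 2 [← up_zero p]
      rw [dist_up, abs_le]; constructor <;> linarith
    · nth_rewrite 2 [← up_zero p]
      rw [dist_up, abs_le]; constructor <;> linarith
    · rwa [dist_up])
  have near : ∀ t, 0 ≤ t → t ≤ τ → dist (up q t) p ≤ 3 * d + 1 := by
    intro t h1 h2
    have a := dist_triangle (up q t) q p
    have b : dist (up q t) q ≤ 2 * d := by
      nth_rewrite 2 [← up_zero q]
      rw [dist_up, abs_le]; constructor <;> linarith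
    rw [dist_comm q p] at a
    linarith
  have B := chain_interval (fun t => F (up q t)) η τ t0 hη (by
    intro s t hs hs' ht ht' hst
    apply h
    · exact near _ hs hs'
    · exact near _ ht ht'
    · rwa [dist_up])
  have M := h (up p d) (up q τ) (by
      nth_rewrite 2 [← up_zero p]
      rw [dist_up, abs_le]; constructor <;> linarith) (near _ t0 le_rfl) hover
  simp only [up_zero] at A B
  have T1 := dist_triangle (F p) (F (up p d)) (F q)
  have T2 := dist_triangle (F (up p d)) (F (up q τ)) (F q)
  rw [dist_comm (F (up q τ))] at T2
  nlinarith

lemma coarse_ivt (h : ℝ → ℝ) (a b c J : ℝ) (hab : a ≤ b)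
    (hj : ∀ s t, a ≤ s → s ≤ b → a ≤ t → t ≤ b → |s - t| ≤ 1 → |h s - h t| ≤ J)
    (ha : h a ≤ c) (hb : c ≤ h b) : ∃ s, a ≤ s ∧ s ≤ b ∧ |h s - c| ≤ J := by
  classical
  by_contra hcon
  push Not at hcon
  have J0 : 0 ≤ J := by simpa using hj a a le_rfl hab le_rfl hab (by simp)
  have := chain_interval (fun s => if h (a + s) < c then (0 : ℝ) else 1) 0 (b - a)
    (by linarith) le_rfl (by
      intro s t hs hs' ht ht' hst
      have e1 := hcon (a + s) (by linarith) (by linarith)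
      have e2 := hcon (a + t) (by linarith) (by linarith)
      have e3 := hj (a + s) (a + t) (by linarith) (by linarith) (by linarith) (by linarith)
        (by simpa using hst)
      rw [abs_le] at e3
      rw [lt_abs] at e1 e2
      have : (h (a + s) < c) ↔ (h (a + t) < c) := by
        constructor
        · intro hh
          rcases e1 with e1 | e1 <;> rcases e2 with e2 | e2 <;> linarith
        · intro hh
          rcases e1 with e1 | e1 <;> rcases e2 with e2 | e2 <;> linarith
      simp [this])
  have e1 := hcon a le_rfl hab
  have e2 := hcon b hab le_rfl
  rw [lt_abs] at e1 e2
  have q1 : h a < c := by rcases e1 with e1 | e1 <;> linarith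
  have q2 : ¬ h b < c := by linarith
  simp [q1, q2] at this
  norm_num at this

lemma coarse_cover (h : ℝ → ℝ) (K lam m J c : ℝ) (hK : 0 ≤ K) (hlam : 0 < lam)
    (hj : ∀ s t, |s| ≤ K → |t| ≤ K → |s - t| ≤ 1 → |h s - h t| ≤ J)
    (hl : ∀ s t, |s| ≤ K → |t| ≤ K → |s - t| / lam - m ≤ |h s - h t|)
    (hG : J < K / lam - m) (hc : |c - h 0| ≤ K / lam - m) :
    ∃ s, |s| ≤ K ∧ |h s - c| ≤ J := by
  wlog hpos : h 0 ≤ h K generalizing h c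
  · obtain ⟨s, hs, hs'⟩ := this (fun s => - h s) (-c)
      (by intro s t a b d; rw [neg_sub_neg, abs_sub_comm]; exact hj s t a b d)
      (by intro s t a b; rw [neg_sub_neg, abs_sub_comm (h t)]; exact hl s t a b)
      (by rw [neg_sub_neg, abs_sub_comm]; exact hc) (by show -h 0 ≤ -h K; linarith)
    refine ⟨s, hs, ?_⟩
    rw [neg_sub_neg, abs_sub_comm] at hs'
    exact hs'
  have J0 : 0 ≤ J := by simpa using hj 0 0 (by simpa) (by simpa) (by simp)
  have aK : |K| ≤ K := by rw [abs_of_nonneg hK]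
  have aK' : |-K| ≤ K := by rw [abs_neg]; exact aK
  have a0 : |(0 : ℝ)| ≤ K := by simpa
  have h1 := hl K 0 aK a0
  have h2 := hl (-K) 0 aK' a0
  rw [sub_zero, abs_of_nonneg hK, abs_of_nonneg (by linarith : 0 ≤ h K - h 0)] at h1
  rw [sub_zero, abs_neg, abs_of_nonneg hK] at h2
  have h3 : h (-K) ≤ h 0 - (K / lam - m) := by
    by_contra hcon
    have h4 : K / lam - m ≤ h (-K) - h 0 := by
      rcases le_abs.1 h2 with h2 | h2 <;> linarith
    rcases le_total (h (-K)) (h K) with h5 | h5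
    · obtain ⟨s, s0, s1, hs⟩ := coarse_ivt h 0 K (h (-K)) J hK (by
        intro s t p1 p2 p3 p4 p5
        exact hj s t (by rw [abs_le]; constructor <;> linarith)
          (by rw [abs_le]; constructor <;> linarith) p5) (by linarith) h5
      have := hl s (-K) (by rw [abs_le]; constructor <;> linarith) aK'
      rw [sub_neg_eq_add, abs_of_nonneg (by linarith : 0 ≤ s + K)] at this
      have : K / lam ≤ (s + K) / lam := by gcongr; linarith
      linarith
    · obtain ⟨s, s0, s1, hs⟩ := coarse_ivt (fun s => h (-s)) 0 K (h K) J hK (by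
        intro s t p1 p2 p3 p4 p5
        exact hj (-s) (-t) (by rw [abs_le]; constructor <;> linarith)
          (by rw [abs_le]; constructor <;> linarith)
          (by rw [neg_sub_neg, abs_sub_comm]; exact p5)) (by simpa using hpos) h5
      have := hl K (-s) aK (by rw [abs_le]; constructor <;> linarith)
      rw [sub_neg_eq_add, abs_of_nonneg (by linarith : 0 ≤ K + s), abs_sub_comm] at this
      have : K / lam ≤ (K + s) / lam := by gcongr; linarith
      linarith
  rw [abs_le] at hc
  obtain ⟨s, s0, s1, hs⟩ := coarse_ivt h (-K) K c J (by linarith) (by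
    intro s t p1 p2 p3 p4 p5
    exact hj s t (abs_le.2 ⟨p1, p2⟩) (abs_le.2 ⟨p3, p4⟩) p5) (by linarith) (by linarith)
  exact ⟨s, abs_le.2 ⟨s0, s1⟩, hs⟩

lemma qie_lower {lam eps : ℝ} {φ : H2R → H2R} (hlam : 1 ≤ lam) (h : IsQIE lam eps φ) (p q : H2R) :
    dist p q ≤ lam * (dist (φ p) (φ q) + eps) := by
  have := (h p q).1
  have hl : 0 < lam := by linarith
  have e : lam * ((1 / lam) * dist p q) = dist p q := by field_simp
  nlinarith

lemma vadd_sinh (w : ℍ) (a b : ℝ) :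
    Real.sinh (dist ((a * w.im : ℝ) +ᵥ w) ((b * w.im : ℝ) +ᵥ w) / 2) = |a - b| / 2 := by
  have hw := w.im_pos
  rw [sinh_half_dist, vadd_im, vadd_im, Real.sqrt_mul_self hw.le, Complex.dist_of_im_eq]
  · simp only [coe_re, vadd_re]
    rw [Real.dist_eq]
    have : a * w.im + w.re - (b * w.im + w.re) = (a - b) * w.im := by ring
    rw [this, abs_mul, abs_of_pos hw]
    field_simp
  · simp

lemma free_fiber (lam eps : ℝ) (φ : H2R → H2R) (hlam : 1 ≤ lam) (heps : 0 ≤ eps)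
    (hφ : IsQIE lam eps φ) (z x w : ℍ) (r K Q S₀ V : ℝ) (hr : 0 ≤ r)
    (hS : S₀ = 2 * (r + lam * (2 * r + 1 + eps) + 1)) (hQ : dist w x ≤ Q)
    (hV : V = lam * (S₀ + Q + K) + eps) (hN : 2 * V + 4 ≤ Real.exp r) :
    ∃ w', dist w w' ≤ S₀ ∧ ∀ s, |s| ≤ K → r ≤ dist (horiz (φ (mk2 w' s))) z := by
  set c := Real.exp (lam * (2 * r + 1 + eps)) with hc
  have cpos : 0 < c := Real.exp_pos _
  have tpos : 0 ≤ lam * (2 * r + 1 + eps) := by positivity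
  have c1 : 1 ≤ c := Real.one_le_exp tpos
  set N := ⌊Real.exp r⌋₊ with hNdef
  set W : ℕ → ℍ := fun k => ((k * c * w.im : ℝ) +ᵥ w) with hW
  have hdist : ∀ k, k < N → dist w (W k) ≤ S₀ := by
    intro k hk
    have e := vadd_sinh w 0 (k * c)
    simp only [zero_mul, zero_vadd, zero_sub, abs_neg] at e
    rw [abs_of_nonneg (by positivity)] at e
    have hkN : (k : ℝ) ≤ Real.exp r := by
      have : (k : ℝ) ≤ N := by exact_mod_cast hk.le
      exact this.trans (Nat.floor_le (Real.exp_pos r).le)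
    have : Real.sinh (dist w (W k) / 2) ≤ Real.sinh (S₀ / 2) := by
      rw [hW]; simp only
      rw [e, hS, Real.sinh_eq]
      have s1 : 2 * (r + lam * (2 * r + 1 + eps) + 1) / 2 = r + lam * (2 * r + 1 + eps) + 1 := by
        ring
      rw [s1]
      have s2 : Real.exp (r + lam * (2 * r + 1 + eps) + 1) = Real.exp r * c * Real.exp 1 := by
        rw [Real.exp_add, Real.exp_add]
      have s3 : Real.exp (-(r + lam * (2 * r + 1 + eps) + 1)) ≤ 1 :=
        Real.exp_le_one_iff.2 (by linarith)
      have s4 : 2 ≤ Real.exp 1 := by linarith [Real.add_one_le_exp (1 : ℝ)]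
      have s5 : (k : ℝ) * c ≤ Real.exp r * c := by gcongr
      have s6 : 1 ≤ Real.exp r * c := one_le_mul_of_one_le_of_one_le (Real.one_le_exp hr) c1
      rw [s2]
      nlinarith
    have := Real.sinh_le_sinh.1 this
    linarith
  by_contra hcon
  push Not at hcon
  have hbad : ∀ k : ℕ, ∃ s, k < N → (|s| ≤ K ∧ dist (horiz (φ (mk2 (W k) s))) z < r) := by
    intro k
    by_cases hk : k < N
    · obtain ⟨s, h1, h2⟩ := hcon (W k) (hdist k hk)
      exact ⟨s, fun _ => ⟨h1, h2⟩⟩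
    · exact ⟨0, fun h => absurd h hk⟩
  choose s hs using hbad
  set h₀ := vert (φ (mk2 x 0))
  set f : ℕ → ℤ := fun k => ⌊vert (φ (mk2 (W k) (s k))) - h₀⌋ with hf
  have hNlt : Real.exp r < N + 1 := Nat.lt_floor_add_one _
  have hmaps : ∀ k ∈ Finset.range N, f k ∈ Finset.Icc (-⌈V⌉) ⌈V⌉ := by
    intro k hk
    rw [Finset.mem_range] at hk
    obtain ⟨h1, h2⟩ := hs k hk
    have d1 := dist_vert_le (φ (mk2 (W k) (s k))) (φ (mk2 x 0))
    have d2 := (hφ (mk2 (W k) (s k)) (mk2 x 0)).2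
    have d3 := dist_le_add (mk2 (W k) (s k)) (mk2 x 0)
    simp only [horiz_mk2, vert_mk2, sub_zero] at d3
    have d4 := dist_triangle (W k) w x
    have d5 := hdist k hk
    rw [dist_comm] at d5
    have d6 : |vert (φ (mk2 (W k) (s k))) - h₀| ≤ V := by
      rw [hV]
      have : lam * dist (mk2 (W k) (s k)) (mk2 x 0) ≤ lam * (S₀ + Q + K) := by
        gcongr; linarith
      linarith
    rw [abs_le] at d6
    rw [Finset.mem_Icc]
    have hce := Int.le_ceil V
    constructor
    · apply Int.le_floor.2
      push_cast
      linarith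
    · have := Int.floor_le (vert (φ (mk2 (W k) (s k))) - h₀)
      have : ((f k : ℤ) : ℝ) ≤ (⌈V⌉ : ℤ) := by rw [hf]; simp only; linarith
      exact_mod_cast this
  have hcard : (Finset.Icc (-⌈V⌉) ⌈V⌉).card < (Finset.range N).card := by
    rw [Finset.card_range, Int.card_Icc]
    have h1 := Int.ceil_lt_add_one V
    have h2 : (((2 * ⌈V⌉ + 1 : ℤ)) : ℝ) < ((N : ℤ) : ℝ) := by
      push_cast; linarith
    have h3 : 2 * ⌈V⌉ + 1 < (N : ℤ) := by exact_mod_cast h2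
    have h4 : (0 : ℝ) < N := by linarith [Real.one_le_exp hr, hN, Real.add_one_le_exp r, (by
      by_contra hv
      push Not at hv
      have : (N : ℝ) = 0 := le_antisymm hv (Nat.cast_nonneg _)
      have : N = 0 := by exact_mod_cast this
      have := Nat.floor_eq_zero.1 this
      linarith [Real.one_le_exp hr] : (0:ℝ) < N)]
    have h5 : 0 < N := by exact_mod_cast h4
    omega
  obtain ⟨i, hi, j, hj, hij, hfij⟩ := Finset.exists_ne_map_eq_of_card_lt_of_maps_to hcard hmaps
  rw [Finset.mem_range] at hi hj
  obtain ⟨i1, i2⟩ := hs i hi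
  obtain ⟨j1, j2⟩ := hs j hj
  have hv : |vert (φ (mk2 (W i) (s i))) - vert (φ (mk2 (W j) (s j)))| ≤ 1 := by
    have := Int.abs_sub_lt_one_of_floor_eq_floor hfij
    have e : vert (φ (mk2 (W i) (s i))) - h₀ - (vert (φ (mk2 (W j) (s j))) - h₀) =
      vert (φ (mk2 (W i) (s i))) - vert (φ (mk2 (W j) (s j))) := by ring
    rw [e] at this
    exact this.le
  have hd := dist_le_add (φ (mk2 (W i) (s i))) (φ (mk2 (W j) (s j)))
  have ht := dist_triangle_right (horiz (φ (mk2 (W i) (s i)))) (horiz (φ (mk2 (W j) (s j)))) z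
  have hq := qie_lower hlam hφ (mk2 (W i) (s i)) (mk2 (W j) (s j))
  have hh := dist_horiz_le (mk2 (W i) (s i)) (mk2 (W j) (s j))
  simp only [horiz_mk2] at hh
  have hfin : dist (W i) (W j) ≤ lam * (2 * r + 1 + eps) := by
    refine hh.trans (hq.trans ?_)
    gcongr
    linarith
  have e := vadd_sinh w (i * c) (j * c)
  have e1 : Real.sinh (dist (W i) (W j) / 2) < c / 2 := by
    have a1 : Real.sinh (dist (W i) (W j) / 2) ≤ Real.sinh (lam * (2 * r + 1 + eps)) :=
      Real.sinh_le_sinh.2 (by linarith)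
    rw [Real.sinh_eq (lam * _)] at a1
    have := Real.exp_pos (-(lam * (2 * r + 1 + eps)))
    linarith
  have e2 : 1 ≤ |(i : ℝ) - j| := by
    have : (1 : ℤ) ≤ |(i : ℤ) - j| := Int.one_le_abs (sub_ne_zero.2 (by exact_mod_cast hij))
    exact_mod_cast this
  rw [hW] at e1
  simp only at e1
  rw [e, ← sub_mul, abs_mul, abs_of_pos cpos] at e1
  nlinarith

lemma core (lam eps kp : ℝ) (φ : H2R → H2R) (hlam : 1 ≤ lam) (heps : 0 ≤ eps) (hkp : 0 ≤ kp)
    (hφ : IsQIE lam eps φ) (hsur : ∀ u, ∃ p, dist (φ p) u ≤ kp) (x y : ℍ)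
    (r D S₀ R Q r₃ K V η : ℝ) (hr : 2 ≤ r) (hD : D = dist x y)
    (hl : dist (horiz (φ (mk2 x 0))) (horiz (φ (mk2 y 0))) ≤ r)
    (hS : S₀ = 2 * (r + lam * (2 * r + 1 + eps) + 1))
    (hR : R = r + kp + lam * (3 * S₀ + 1) + eps)
    (hQ : Q = lam * (R + kp + eps))
    (hr₃ : r₃ = r + lam * (3 * (Q + S₀) + 1) + eps)
    (hK : K = lam * (lam * D + 2 * eps + 2 * r₃ + lam + 1))
    (hV : V = lam * (S₀ + Q + K) + eps)
    (hη : η = 4 * Real.sinh ((lam + eps + kp) / 2) * Real.exp (-r))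
    (H1 : lam * (r₃ + r + lam + 2 * eps) < D)
    (H3 : 2 * V + 4 ≤ Real.exp r)
    (H4 : 2 * (1 + (3 * S₀ + 3) + (2 * K + 1) + (3 * (Q + S₀) + 3)) * η < 1) : False := by
  have l0 : 0 < lam := by linarith
  have D0 : 0 ≤ D := hD ▸ dist_nonneg
  have S0 : 0 ≤ S₀ := by rw [hS]; positivity
  have R0 : r ≤ R := by
    have : 0 ≤ lam * (3 * S₀ + 1) := by positivity
    linarith
  have Q0 : 0 ≤ Q := by rw [hQ]; exact mul_nonneg l0.le (by linarith)
  have r30 : Q ≤ r₃ := by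
    have : 3 * (Q + S₀) + 1 ≤ lam * (3 * (Q + S₀) + 1) := by
      apply le_mul_of_one_le_left _ hlam
      positivity
    linarith
  have K0 : Q ≤ K := by
    have h1 : 0 ≤ lam * D := by positivity
    have : lam * D + 2 * eps + 2 * r₃ + lam + 1 ≤ K := by
      rw [hK]
      exact le_mul_of_one_le_left (by linarith) hlam
    linarith
  have η0 : 0 ≤ η := by
    rw [hη]
    have := Real.sinh_nonneg_iff.2 (by positivity : 0 ≤ (lam + eps + kp) / 2)
    positivity
  set z := horiz (φ (mk2 x 0)) with hz
  set h₀ := vert (φ (mk2 x 0)) with hh₀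
  -- coarse Lipschitz estimate for the distance to the fibre over z
  have rho : ∀ p q, dist (horiz (φ p)) z - lam * dist p q - eps ≤ dist (horiz (φ q)) z := by
    intro p q
    have h1 := (hφ p q).2
    have h2 := dist_horiz_le (φ p) (φ q)
    have h3 := dist_triangle (horiz (φ p)) (horiz (φ q)) z
    linarith
  -- a point of the fibre over x far from the fibre over z
  have stepA : ∃ s, |s| ≤ K ∧ r₃ ≤ dist (horiz (φ (mk2 x s))) z := by
    by_contra hcon
    push Not at hcon
    have hJ : ∀ s t, |vert (φ (mk2 x s)) - vert (φ (mk2 x t))| ≤ lam * |s - t| + eps := by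
      intro s t
      have h1 := (hφ (mk2 x s) (mk2 x t)).2
      have h2 := dist_vert_le (φ (mk2 x s)) (φ (mk2 x t))
      have h3 := mul_le_mul_of_nonneg_left (dist_mk2_same_horiz x s t) l0.le
      linarith
    have hKl : K / lam = lam * D + 2 * eps + 2 * r₃ + lam + 1 := by
      rw [hK]; field_simp
    obtain ⟨s, hs, hs'⟩ := coarse_cover (fun s => vert (φ (mk2 x s))) K lam (eps + 2 * r₃)
      (lam + eps) (vert (φ (mk2 y 0))) (by linarith) l0
      (by
        intro s t _ _ hst
        have := hJ s t
        have : lam * |s - t| ≤ lam * 1 := by gcongr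
        linarith)
      (by
        intro s t hs ht
        have a1 := hcon s hs
        have a2 := hcon t ht
        have a3 := dist_triangle_right (horiz (φ (mk2 x s))) (horiz (φ (mk2 x t))) z
        have a4 := dist_le_add (φ (mk2 x s)) (φ (mk2 x t))
        have a5 := (hφ (mk2 x s) (mk2 x t)).1
        have a6 := dist_vert_le (mk2 x s) (mk2 x t)
        simp only [vert_mk2] at a6
        have a7 : |s - t| / lam ≤ 1 / lam * dist (mk2 x s) (mk2 x t) := by
          rw [div_eq_inv_mul, one_div]
          gcongr
        linarith)
      (by
        rw [hKl]
        have : 0 ≤ lam * D := by positivity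
        linarith)
      (by
        rw [hKl]
        have h1 := (hφ (mk2 y 0) (mk2 x 0)).2
        have h2 := dist_vert_le (φ (mk2 y 0)) (φ (mk2 x 0))
        have h3 := mul_le_mul_of_nonneg_left (dist_mk2_same_vert y x 0) l0.le
        rw [dist_comm y x, ← hD] at h3
        linarith)
    have b1 := hcon s hs
    have b2 := dist_le_add (φ (mk2 x s)) (φ (mk2 y 0))
    have b3 := dist_triangle (horiz (φ (mk2 x s))) z (horiz (φ (mk2 y 0)))
    have b4 := qie_lower hlam hφ (mk2 x s) (mk2 y 0)
    have b5 := dist_horiz_le (mk2 x s) (mk2 y 0)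
    simp only [horiz_mk2] at b5 hs'
    rw [← hD] at b5
    have b6 : lam * (dist (φ (mk2 x s)) (φ (mk2 y 0)) + eps)
        ≤ lam * (r₃ + r + lam + 2 * eps) := by
      apply mul_le_mul_of_nonneg_left _ l0.le
      linarith
    linarith
  obtain ⟨ss, hss, hssr⟩ := stepA
  have loc : ∀ q q' : ℍ, r ≤ dist q z → r ≤ dist q' z → dist q q' ≤ lam + eps + kp →
      dist (disc z q) (disc z q') ≤ η := by
    intro q q' h1 h2 h3
    rw [dist_eq_norm, hη]
    exact norm_disc_sub_le z q q' r _ h1 h2 h3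
  have loc' : ∀ p q : H2R, r ≤ dist (horiz (φ p)) z → r ≤ dist (horiz (φ q)) z → dist p q ≤ 1 →
      dist (disc z (horiz (φ p))) (disc z (horiz (φ q))) ≤ η := by
    intro p q h1 h2 h3
    apply loc _ _ h1 h2
    have a1 := dist_horiz_le (φ p) (φ q)
    have a2 := (hφ p q).2
    have : lam * dist p q ≤ lam * 1 := by gcongr
    linarith
  have side : ∀ t, |t| = R → dist (disc z (up z t)) (disc z (horiz (φ (mk2 x ss)))) ≤
      (1 + (3 * S₀ + 3) + (2 * K + 1) + (3 * (Q + S₀) + 3)) * η := by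
    intro t ht
    have hut : dist (up z t) z = R := by
      nth_rewrite 2 [← up_zero z]
      rw [dist_up, sub_zero, ht]
    obtain ⟨p, hp⟩ := hsur (mk2 (up z t) h₀)
    set w := horiz p with hw
    set s := vert p with hs
    have ep : p = mk2 w s := (mk2_eta p).symm
    have p1 := dist_horiz_le (φ p) (mk2 (up z t) h₀)
    rw [horiz_mk2] at p1
    have p2 : R - kp ≤ dist (horiz (φ p)) z := by
      have := dist_triangle_left (up z t) z (horiz (φ p))
      linarith
    have p3 : dist p (mk2 x 0) ≤ Q := by
      refine (qie_lower hlam hφ p (mk2 x 0)).trans ?_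
      rw [hQ]
      have a1 := dist_triangle (φ p) (mk2 (up z t) h₀) (φ (mk2 x 0))
      have a2 : dist (mk2 (up z t) h₀) (φ (mk2 x 0)) ≤ R := by
        rw [← mk2_eta (φ (mk2 x 0)), ← hz, ← hh₀, ← hut]
        exact dist_mk2_same_vert _ _ _
      gcongr
      linarith
    have wx : dist w x ≤ Q := (dist_horiz_le p (mk2 x 0)).trans p3
    have sQ : |s| ≤ Q := by
      have := (dist_vert_le p (mk2 x 0)).trans p3
      rwa [vert_mk2, sub_zero] at this
    obtain ⟨w', hw', hfree⟩ := free_fiber lam eps φ hlam heps hφ z x w r K Q S₀ V (by linarith)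
      hS wx hV H3
    have c1 : dist (disc z (up z t)) (disc z (horiz (φ (mk2 w s)))) ≤ η := by
      rw [← ep]
      apply loc
      · rw [hut]; exact R0
      · have : 0 ≤ lam * (3 * S₀ + 1) := by positivity
        linarith
      · rw [dist_comm]; linarith
    have c2 := chain_H (fun a => disc z (horiz (φ (mk2 a s)))) η S₀ w w' η0 hw' (by
      have good : ∀ a, dist a w ≤ 3 * S₀ + 1 → r ≤ dist (horiz (φ (mk2 a s))) z := by
        intro a ha
        have g1 := rho p (mk2 a s)
        have g2 : dist p (mk2 a s) ≤ 3 * S₀ + 1 := by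
          rw [ep]
          refine (dist_mk2_same_vert _ _ _).trans ?_
          rw [dist_comm]; exact ha
        have g3 : lam * dist p (mk2 a s) ≤ lam * (3 * S₀ + 1) := by gcongr
        linarith
      intro a b ha hb hab
      exact loc' _ _ (good a ha) (good b hb) ((dist_mk2_same_vert _ _ _).trans hab))
    have c3 := chain_real (fun v => disc z (horiz (φ (mk2 w' v)))) η K s ss η0
      (by linarith) hss (by
      intro a b ha hb hab
      exact loc' _ _ (hfree a ha) (hfree b hb) ((dist_mk2_same_horiz _ _ _).trans hab))
    have c4 := chain_H (fun a => disc z (horiz (φ (mk2 a ss)))) η (Q + S₀) x w' η0 (by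
      have := dist_triangle_left x w' w
      linarith) (by
      have good : ∀ a, dist a x ≤ 3 * (Q + S₀) + 1 → r ≤ dist (horiz (φ (mk2 a ss))) z := by
        intro a ha
        have g1 := rho (mk2 x ss) (mk2 a ss)
        have g2 : dist (mk2 x ss) (mk2 a ss) ≤ 3 * (Q + S₀) + 1 := by
          refine (dist_mk2_same_vert _ _ _).trans ?_
          rw [dist_comm]; exact ha
        have g3 : lam * dist (mk2 x ss) (mk2 a ss) ≤ lam * (3 * (Q + S₀) + 1) := by gcongr
        linarith
      intro a b ha hb hab
      exact loc' _ _ (good a ha) (good b hb) ((dist_mk2_same_vert _ _ _).trans hab))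
    rw [dist_comm] at c4
    have t1 := dist_triangle (disc z (up z t)) (disc z (horiz (φ (mk2 w s))))
      (disc z (horiz (φ (mk2 x ss))))
    have t2 := dist_triangle (disc z (horiz (φ (mk2 w s)))) (disc z (horiz (φ (mk2 w' s))))
      (disc z (horiz (φ (mk2 x ss))))
    have t3 := dist_triangle (disc z (horiz (φ (mk2 w' s)))) (disc z (horiz (φ (mk2 w' ss))))
      (disc z (horiz (φ (mk2 x ss))))
    linarith
  have RR : |R| = R := abs_of_nonneg (by linarith)
  have s1 := side R RR
  have s2 := side (-R) (by rw [abs_neg, RR])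
  have s3 := disc_up_sub z R (by linarith)
  rw [← dist_eq_norm] at s3
  have s4 := dist_triangle_right (disc z (up z R)) (disc z (up z (-R)))
    (disc z (horiz (φ (mk2 x ss))))
  linarith

lemma ev_affine (f : ℝ → ℝ) (hf : ∃ a b, ∀ r, f r = a + b * r) :
    ∀ᶠ r in Filter.atTop, f r < Real.exp (r / 2) := by
  obtain ⟨a, b, h⟩ := hf
  have h1 := Real.tendsto_pow_mul_exp_neg_atTop_nhds_zero 1
  have h0 := Real.tendsto_pow_mul_exp_neg_atTop_nhds_zero 0
  have hh : Filter.Tendsto (fun r : ℝ => r / 2) Filter.atTop Filter.atTop :=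
    Filter.tendsto_id.atTop_div_const (by norm_num)
  have h2 := ((h0.comp hh).const_mul a).add ((h1.comp hh).const_mul (2 * b))
  simp only [mul_zero, add_zero] at h2
  filter_upwards [h2.eventually (gt_mem_nhds (zero_lt_one))] with r hr
  simp only [Function.comp, pow_zero, pow_one, one_mul, Real.exp_neg] at hr
  rw [h]
  have e := Real.exp_pos (r / 2)
  have : (a + b * r) / Real.exp (r / 2) < 1 := by
    rw [div_eq_mul_inv]
    nlinarith
  rwa [div_lt_one e] at this

lemma ev_affine_exp (f : ℝ → ℝ) (hf : ∃ a b c, ∀ r, f r = a + b * r + c * Real.exp (r / 2)) :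
    ∀ᶠ r in Filter.atTop, f r < Real.exp r := by
  obtain ⟨a, b, c, h⟩ := hf
  filter_upwards [ev_affine (fun r => a + b * r) ⟨a, b, fun _ => rfl⟩,
    ev_affine (fun r => 1 + c) ⟨1 + c, 0, by simp⟩] with r h1 h2
  have e : Real.exp r = Real.exp (r / 2) * Real.exp (r / 2) := by
    rw [← Real.exp_add]; ring_nf
  have := Real.exp_pos (r / 2)
  rw [h, e]
  nlinarith

/-- A quasi-isometry of `ℍ ×₂ ℝ` cannot decrease horizontal distances more than
exponentially: `dist x y ≤ C (eˡ + 1)` where `l` is the hyperbolic distance between the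
horizontal coordinates of `φ(x,0)` and `φ(y,0)`. -/
theorem horizontal_expansion_bound (lam eps kap : ℝ) (hlam : 1 ≤ lam) (heps : 0 ≤ eps)
    (hkap : 0 ≤ kap) :
    ∃ C > (0 : ℝ), ∀ φ φ' : H2R → H2R, IsQIE lam eps φ → IsQIE lam eps φ' →
      (∀ x : H2R, dist (φ' (φ x)) x ≤ kap) →
      ∀ x y : UpperHalfPlane,
        dist x y ≤
          C * (Real.exp (dist (horiz (φ (mk2 x 0))) (horiz (φ (mk2 y 0)))) + 1) := by
  have l0 : 0 < lam := by linarith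
  set kp := lam * (kap + eps) with hkp
  have kp0 : 0 ≤ kp := by positivity
  let S : ℝ → ℝ := fun r => 2 * (r + lam * (2 * r + 1 + eps) + 1)
  let R : ℝ → ℝ := fun r => r + kp + lam * (3 * S r + 1) + eps
  let Q : ℝ → ℝ := fun r => lam * (R r + kp + eps)
  let r₃ : ℝ → ℝ := fun r => r + lam * (3 * (Q r + S r) + 1) + eps
  let K : ℝ → ℝ := fun r => lam * (lam * Real.exp (r / 2) + 2 * eps + 2 * r₃ r + lam + 1)
  let V : ℝ → ℝ := fun r => lam * (S r + Q r + K r) + eps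
  set σ := 4 * Real.sinh ((lam + eps + kp) / 2) with hσ
  have hS : ∀ r, S r = S 0 + (S 1 - S 0) * r := by intro r; simp only [S]; ring
  have hQ : ∀ r, Q r = Q 0 + (Q 1 - Q 0) * r := by intro r; simp only [Q, R, S]; ring
  have hr₃ : ∀ r, r₃ r = r₃ 0 + (r₃ 1 - r₃ 0) * r := by
    intro r; simp only [r₃]; rw [hQ r, hS r]; ring
  have E1 := ev_affine (fun r => lam * (r₃ r + r + lam + 2 * eps))
    ⟨lam * (r₃ 0 + lam + 2 * eps), lam * (r₃ 1 - r₃ 0 + 1), by intro r; rw [hr₃ r]; ring⟩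
  have hK : ∀ r, K r = lam * (2 * eps + 2 * r₃ 0 + lam + 1) + (2 * lam * (r₃ 1 - r₃ 0)) * r
      + lam * lam * Real.exp (r / 2) := by
    intro r; simp only [K]; rw [hr₃ r]; ring
  generalize lam * (2 * eps + 2 * r₃ 0 + lam + 1) = k1 at hK
  generalize 2 * lam * (r₃ 1 - r₃ 0) = k2 at hK
  have E2 := ev_affine_exp (fun r => 2 * V r + 4)
    ⟨2 * (lam * (S 0 + Q 0 + k1) + eps) + 4, 2 * lam * (S 1 - S 0 + (Q 1 - Q 0) + k2),
      2 * lam * lam * lam, by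
      intro r; simp only [V]; rw [hK r, hS r, hQ r]; ring⟩
  have E3 := ev_affine_exp
    (fun r => 2 * (1 + (3 * S r + 3) + (2 * K r + 1) + (3 * (Q r + S r) + 3)) * σ)
    ⟨2 * (1 + (3 * S 0 + 3) + (2 * k1 + 1) + (3 * (Q 0 + S 0) + 3)) * σ,
      2 * (3 * (S 1 - S 0) + 2 * k2 + 3 * (Q 1 - Q 0 + (S 1 - S 0))) * σ,
      4 * lam * lam * σ, by
      intro r; rw [hK r, hS r, hQ r]; ring⟩
  obtain ⟨r₀, hr₀⟩ := Filter.eventually_atTop.1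
    ((E1.and (E2.and E3)).and (Filter.eventually_ge_atTop 2))
  have hr02 : 2 ≤ r₀ := (hr₀ r₀ le_rfl).2
  refine ⟨Real.exp (r₀ / 2), Real.exp_pos _, ?_⟩
  intro φ φ' hφ hφ' hinv x y
  by_contra hcon
  push Not at hcon
  set l := dist (horiz (φ (mk2 x 0))) (horiz (φ (mk2 y 0))) with hl
  have el := Real.exp_pos l
  have c1 : 1 ≤ Real.exp (r₀ / 2) := Real.one_le_exp (by linarith)
  have d1 : Real.exp (r₀ / 2) < dist x y := by nlinarith
  have d2 : Real.exp l < dist x y := by nlinarith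
  have d0 : 0 < dist x y := by linarith
  set r := 2 * Real.log (dist x y) with hr
  have er : Real.exp (r / 2) = dist x y := by
    rw [hr, mul_div_cancel_left₀ _ (by norm_num : (2 : ℝ) ≠ 0), Real.exp_log d0]
  have rr : r₀ ≤ r := by
    have := (Real.lt_log_iff_exp_lt d0).2 d1
    linarith
  have lr : l ≤ r := by
    have h1 := (Real.lt_log_iff_exp_lt d0).2 d2
    have h2 : 0 ≤ Real.log (dist x y) := Real.log_nonneg (by linarith)
    linarith
  obtain ⟨⟨F1, F2, F3⟩, F4⟩ := hr₀ r rr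
  refine core lam eps kp φ hlam heps kp0 hφ ?_ x y r (Real.exp (r / 2)) (S r) (R r) (Q r) (r₃ r)
    (K r) (V r) (σ * Real.exp (-r)) F4 er lr rfl rfl rfl rfl rfl rfl rfl F1 F2.le ?_
  · intro u
    refine ⟨φ' u, ?_⟩
    refine (qie_lower hlam hφ' _ _).trans ?_
    rw [hkp]
    gcongr
    exact hinv (φ' u)
  · rw [← mul_assoc, Real.exp_neg, ← div_eq_mul_inv, div_lt_one (Real.exp_pos r)]
    exact F3
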